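/- Let n ≥ 1 and k ≥ 1 be integers, let G(z) = z^k, and let h be a holomorphic function on a neighborhood of 0 ∈ ℂ with h(z) = a z^(n+k) + b z^(n+k+1) + O(z^(n+k+2)) as z → 0, for some a, b ∈ ℂ with a ≠ 0. On a punctured neighborhood of 0 where h does not vanish, define ρ = ρ[G, h] = G'''/G' + G''/(2G) − 3(G')²/(4G²) − 7(G'')²/(4(G')²) + G'' h'/(2 G' h) − G' h'/(2 G h) − h''/h + 5(h')²/(4h²). Then lim_{z→0} z² ρ(z) = ((n+k+1)² − 4k²)/4; in particular this limit is zero if and only if n − k + 1 = 0. (This is the analytic content of the statement that at a branch point of order n and index k the entropy differential P = (ρ/2) dz² has a double pole with leading coefficient ((n+k+1)² − 4k²)/8, unless n − k + 1 = 0, in which case it has at most a simple pole.) -/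

import Mathlib

open Filter Asymptotics

/-- The coefficient `ρ[G,h]` of the entropy differential `P = (ρ/2) dz²` of the
(branched) minimal surface with Weierstrass data `(G, h dz)`. -/
noncomputable def rhoWeierstrass (G h : ℂ → ℂ) (z : ℂ) : ℂ :=
  deriv (deriv (deriv G)) z / deriv G z
    + deriv (deriv G) z / (2 * G z)
    - 3 * (deriv G z) ^ 2 / (4 * (G z) ^ 2)
    - 7 * (deriv (deriv G) z) ^ 2 / (4 * (deriv G z) ^ 2)
    + deriv (deriv G) z * deriv h z / (2 * deriv G z * h z)
    - deriv G z * deriv h z / (2 * G z * h z)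
    - deriv (deriv h) z / h z
    + 5 * (deriv h z) ^ 2 / (4 * (h z) ^ 2)

/-- If `f ~ a z^m` at the origin with `a ≠ 0` and `f` is analytic there, then `f = z^m g` near the
origin with `g` analytic and nonvanishing there. -/
theorem AnalyticAt.exists_eventuallyEq_pow_mul_of_tendsto_div {f : ℂ → ℂ} (hf : AnalyticAt ℂ f 0)
    {m : ℕ} {a : ℂ} (ha : a ≠ 0)
    (hlim : Tendsto (fun z => f z / z ^ m) (nhdsWithin 0 {0}ᶜ) (nhds a)) :
    ∃ g : ℂ → ℂ, AnalyticAt ℂ g 0 ∧ g 0 ≠ 0 ∧ ∀ᶠ z in nhds 0, f z = z ^ m * g z := by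
  have hnz : ¬ ∀ᶠ z in nhds 0, f z = 0 := by
    intro h0
    refine ha (tendsto_nhds_unique hlim (tendsto_const_nhds.congr' ?_))
    filter_upwards [h0.filter_mono nhdsWithin_le_nhds] with z hz
    simp [hz]
  obtain ⟨N, g, hg, hg0, hfg⟩ := hf.exists_eventuallyEq_pow_smul_nonzero_iff.mpr hnz
  simp only [sub_zero, smul_eq_mul] at hfg
  have hfg' := hfg.filter_mono (nhdsWithin_le_nhds (s := {0}ᶜ))
  have hgt : Tendsto g (nhdsWithin 0 {0}ᶜ) (nhds (g 0)) :=
    hg.continuousAt.tendsto.mono_left nhdsWithin_le_nhds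
  have hpow : ∀ d : ℕ, 0 < d →
      Tendsto (fun z : ℂ => z ^ d) (nhdsWithin 0 {0}ᶜ) (nhds 0) := fun d hd => by
    have := (continuous_pow (M := ℂ) d).tendsto 0
    rw [zero_pow hd.ne'] at this
    exact this.mono_left nhdsWithin_le_nhds
  have hN : N = m := by
    rcases lt_trichotomy N m with hlt | heq | hgt'
    · obtain ⟨d, rfl⟩ := Nat.exists_eq_add_of_lt hlt
      refine absurd (tendsto_nhds_unique hgt (Tendsto.congr' ?_ ((hpow (d + 1) d.succ_pos).mul hlim)))
        (by simpa using hg0)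
      filter_upwards [hfg', self_mem_nhdsWithin] with z hz hz0
      have hz0 : z ≠ 0 := hz0
      rw [hz]
      field_simp
      ring
    · exact heq
    · obtain ⟨d, rfl⟩ := Nat.exists_eq_add_of_lt hgt'
      refine absurd (tendsto_nhds_unique hlim (Tendsto.congr' ?_ ((hpow (d + 1) d.succ_pos).mul hgt)))
        (by simpa using ha)
      filter_upwards [hfg', self_mem_nhdsWithin] with z hz hz0
      have hz0 : z ≠ 0 := hz0
      rw [hz]
      field_simp
      ring
  exact ⟨g, hg, hg0, hN ▸ hfg⟩

/-- The derivative of a monomial, written with the same power. -/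
theorem natCast_mul_pow_pred (j : ℕ) {z : ℂ} (hz : z ≠ 0) :
    (j : ℂ) * z ^ (j - 1) = j * z ^ j / z := by
  cases j with
  | zero => simp
  | succ j => field_simp; simp [pow_succ]

/-- The first derivative of `w ^ m * g w`. -/
theorem eventually_deriv_pow_mul {f g : ℂ → ℂ} (hg : AnalyticAt ℂ g 0) (m : ℕ)
    (hfg : ∀ᶠ z in nhds 0, f z = z ^ m * g z) :
    ∀ᶠ z in nhds 0, deriv f z = m * z ^ (m - 1) * g z + z ^ m * deriv g z := by
  filter_upwards [hfg.eventually_nhds, hg.eventually_analyticAt] with z hz hgz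
  rw [Filter.EventuallyEq.deriv_eq hz]
  exact ((hasDerivAt_pow m z).mul hgz.differentiableAt.hasDerivAt).deriv

/-- The second derivative of `w ^ m * g w`. -/
theorem eventually_deriv_deriv_pow_mul {f g : ℂ → ℂ} (hg : AnalyticAt ℂ g 0) (m : ℕ)
    (hfg : ∀ᶠ z in nhds 0, f z = z ^ m * g z) :
    ∀ᶠ z in nhds 0, deriv (deriv f) z = m * ((m - 1 : ℕ) * z ^ (m - 1 - 1)) * g z
      + 2 * (m * z ^ (m - 1) * deriv g z) + z ^ m * deriv (deriv g) z := by
  filter_upwards [(eventually_deriv_pow_mul hg m hfg).eventually_nhds, hg.eventually_analyticAt]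
    with z hz hgz
  rw [Filter.EventuallyEq.deriv_eq hz]
  have h1 := ((((hasDerivAt_pow (m - 1) z).const_mul (m : ℂ)).mul
    hgz.differentiableAt.hasDerivAt).add
    ((hasDerivAt_pow m z).mul hgz.deriv.differentiableAt.hasDerivAt)).deriv
  refine h1.trans ?_
  ring

/-- The entropy coefficient of `(z^k, h dz)` in terms of `u = z h'/h` and `v = z² h''/h`. -/
theorem sq_mul_rhoWeierstrass_pow {k : ℕ} (hk : 1 ≤ k) {h : ℂ → ℂ} {z : ℂ} (hz : z ≠ 0)
    (hhz : h z ≠ 0) :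
    z ^ 2 * rhoWeierstrass (fun w => w ^ k) h z =
      1 / 4 - (k : ℂ) ^ 2 - (z * deriv h z / h z) / 2 - z ^ 2 * deriv (deriv h) z / h z
        + 5 / 4 * (z * deriv h z / h z) ^ 2 := by
  obtain ⟨j, rfl⟩ := Nat.exists_eq_add_of_le' hk
  have d1 : deriv (fun w : ℂ => w ^ (j + 1)) = fun w => ((j : ℂ) + 1) * w ^ j := by
    funext w; simp
  have d2 : deriv (fun w : ℂ => ((j : ℂ) + 1) * w ^ j) =
      fun w => ((j : ℂ) + 1) * (j * w ^ (j - 1)) := by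
    funext w; simp
  have d3 : deriv (fun w : ℂ => ((j : ℂ) + 1) * (j * w ^ (j - 1))) z =
      ((j : ℂ) + 1) * (j * (j - 1) * z ^ j / z ^ 2) := by
    have h1 : deriv (fun w : ℂ => ((j : ℂ) + 1) * (j * w ^ (j - 1))) z =
      ((j : ℂ) + 1) * (j * ((j - 1 : ℕ) * z ^ (j - 1 - 1))) := by simp
    rw [h1, natCast_mul_pow_pred _ hz]
    cases j with
    | zero => simp
    | succ i => simp only [Nat.add_sub_cancel]; push_cast; field_simp; ring
  have hj : (j : ℂ) + 1 ≠ 0 := by exact_mod_cast j.succ_ne_zero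
  unfold rhoWeierstrass
  rw [d1, d2, d3]
  simp only [natCast_mul_pow_pred _ hz, pow_succ z j]
  have hzj : z ^ j ≠ 0 := pow_ne_zero _ hz
  generalize z ^ j = Z at *
  push_cast
  field_simp
  ring

/-- At a branch point of order `n` and index `k`, normalized so that `G(z) = z^k`
and `h(z) = a z^(n+k) + b z^(n+k+1) + O(z^(n+k+2))` with `a ≠ 0`, the entropy
coefficient `ρ = ρ[G,h]` satisfies `z² ρ(z) → ((n+k+1)² - 4k²)/4` as `z → 0`,
and this limit vanishes if and only if `n - k + 1 = 0`. -/
theorem entropy_pole_at_branch_point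
    (n k : ℕ) (hn : 1 ≤ n) (hk : 1 ≤ k)
    (U : Set ℂ) (hU : IsOpen U) (h0 : (0 : ℂ) ∈ U)
    (h : ℂ → ℂ) (hh : DifferentiableOn ℂ h U)
    (a b : ℂ) (ha : a ≠ 0)
    (hexp : (fun z : ℂ => h z - a * z ^ (n + k) - b * z ^ (n + k + 1))
      =O[nhds 0] fun z : ℂ => z ^ (n + k + 2)) :
    Tendsto (fun z : ℂ => z ^ 2 * rhoWeierstrass (fun w => w ^ k) h z)
        (nhdsWithin 0 {0}ᶜ)
        (nhds ((((n : ℂ) + k + 1) ^ 2 - 4 * (k : ℂ) ^ 2) / 4)) ∧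
      (((((n : ℂ) + k + 1) ^ 2 - 4 * (k : ℂ) ^ 2) / 4 = 0) ↔
        ((n : ℤ) - k + 1 = 0)) := by
  have hana : AnalyticAt ℂ h 0 := hh.analyticAt (hU.mem_nhds h0)
  have hid : Tendsto (fun z : ℂ => z) (nhdsWithin 0 {0}ᶜ) (nhds 0) :=
    tendsto_id.mono_left nhdsWithin_le_nhds
  have hlim : Tendsto (fun z => h z / z ^ (n + k)) (nhdsWithin 0 {0}ᶜ) (nhds a) := by
    have hlo : (fun z : ℂ => h z - a * z ^ (n + k) - b * z ^ (n + k + 1))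
        =o[nhdsWithin 0 {0}ᶜ] fun z : ℂ => z ^ (n + k) :=
      (hexp.trans_isLittleO (isLittleO_pow_pow (by omega))).mono nhdsWithin_le_nhds
    have := (hlo.tendsto_div_nhds_zero.add (hid.const_mul b)).const_add a
    simp only [mul_zero, add_zero] at this
    refine this.congr' ?_
    filter_upwards [self_mem_nhdsWithin] with z hz
    have hz : z ≠ 0 := hz
    field_simp
    ring
  obtain ⟨g, hg, hg0, hfg⟩ := hana.exists_eventuallyEq_pow_mul_of_tendsto_div ha hlim
  obtain ⟨p, hp⟩ : ∃ p, n + k = p + 2 := ⟨n + k - 2, by omega⟩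
  have hpc : (n : ℂ) + k = p + 2 := by exact_mod_cast hp
  rw [hp] at hfg
  refine ⟨?_, ?_⟩
  · have e1 := eventually_deriv_pow_mul hg _ hfg
    have e2 := eventually_deriv_deriv_pow_mul hg _ hfg
    have hgne : ∀ᶠ z in nhds 0, g z ≠ 0 := hg.continuousAt.eventually_ne hg0
    have tg : Tendsto (fun z => deriv g z / g z) (nhdsWithin 0 {0}ᶜ) (nhds (deriv g 0 / g 0)) :=
      (hg.deriv.continuousAt.div hg.continuousAt hg0).tendsto.mono_left nhdsWithin_le_nhds
    have tg2 : Tendsto (fun z => deriv (deriv g) z / g z) (nhdsWithin 0 {0}ᶜ)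
        (nhds (deriv (deriv g) 0 / g 0)) :=
      (hg.deriv.deriv.continuousAt.div hg.continuousAt hg0).tendsto.mono_left nhdsWithin_le_nhds
    have tu : Tendsto (fun z => z * deriv h z / h z) (nhdsWithin 0 {0}ᶜ) (nhds ((p : ℂ) + 2)) := by
      have := (hid.mul tg).const_add ((p : ℂ) + 2)
      simp only [zero_mul, add_zero] at this
      refine this.congr' ?_
      filter_upwards [self_mem_nhdsWithin, hfg.filter_mono nhdsWithin_le_nhds,
        e1.filter_mono nhdsWithin_le_nhds, hgne.filter_mono nhdsWithin_le_nhds] with z hz h1 h2 h3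
      have hz : z ≠ 0 := hz
      rw [h1, h2, show p + 2 - 1 = p + 1 by omega]
      push_cast
      field_simp
      ring
    have tv : Tendsto (fun z => z ^ 2 * deriv (deriv h) z / h z) (nhdsWithin 0 {0}ᶜ)
        (nhds (((p : ℂ) + 2) * (p + 1))) := by
      have := (((hid.mul tg).const_mul (2 * ((p : ℂ) + 2))).add ((hid.pow 2).mul tg2)).const_add
        (((p : ℂ) + 2) * (p + 1))
      simp only [zero_mul, add_zero, mul_zero, ne_eq, OfNat.ofNat_ne_zero, not_false_eq_true,
        zero_pow] at this
      refine this.congr' ?_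
      filter_upwards [self_mem_nhdsWithin, hfg.filter_mono nhdsWithin_le_nhds,
        e2.filter_mono nhdsWithin_le_nhds, hgne.filter_mono nhdsWithin_le_nhds] with z hz h1 h2 h3
      have hz : z ≠ 0 := hz
      rw [h1, h2, show p + 2 - 1 = p + 1 by omega, Nat.add_sub_cancel]
      push_cast
      field_simp
      ring
    have key := (((tu.div_const 2).const_sub (1 / 4 - (k : ℂ) ^ 2)).sub tv).add
      ((tu.pow 2).const_mul (5 / 4))
    rw [hpc]
    convert key.congr' ?_ using 2
    · ring
    · filter_upwards [self_mem_nhdsWithin, hfg.filter_mono nhdsWithin_le_nhds,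
        hgne.filter_mono nhdsWithin_le_nhds] with z hz h1 h3
      have hz : z ≠ 0 := hz
      refine (sq_mul_rhoWeierstrass_pow hk hz ?_).symm
      rw [h1]
      exact mul_ne_zero (pow_ne_zero _ hz) h3
  · have hfac : (((n : ℂ) + k + 1) ^ 2 - 4 * (k : ℂ) ^ 2) / 4 =
        (((n : ℤ) - k + 1 : ℤ) : ℂ) * ((n + 3 * k + 1 : ℕ) : ℂ) / 4 := by
      push_cast
      ring
    have hne : ((n + 3 * k + 1 : ℕ) : ℂ) ≠ 0 := Nat.cast_ne_zero.mpr (Nat.succ_ne_zero _)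
    rw [hfac, div_eq_zero_iff, mul_eq_zero, Int.cast_eq_zero]
    simp [-Nat.cast_add, -Nat.cast_mul, hne]
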